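/- arXiv:1810.13102 — 3 statements merged into one kernel-verified Lean document; each statement's English description precedes it below -/
import Mathlib

section
/- Let X be a complex Banach space, let φ : ℝ → X be uniformly continuous, let λ ∈ ℝ, and let h > 0. Then M_h(g·γ_λ·φ) ∈ g·BUC(ℝ,X); that is, there exists u ∈ BUC(ℝ,X) such that (1/h)·∫₀^h g(t+s)·exp(i·λ·(t+s))·φ(t+s) ds = g(t)·u(t) for all t ∈ ℝ. -/
open Filter intervalIntegral

noncomputable def g (t : ℝ) : ℂ := Complex.exp (Complex.I * (t : ℂ) ^ 2)

noncomputable def gamma (l t : ℝ) : ℂ := Complex.exp (Complex.I * l * t)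

/-- A uniformly continuous function on `ℝ` has at most linear growth. -/
theorem UniformContinuous.exists_norm_sub_le_mul_one_add_abs {E : Type*} [NormedAddCommGroup E]
    {φ : ℝ → E} (hφ : UniformContinuous φ) :
    ∃ C, 0 ≤ C ∧ ∀ t s, ‖φ (t + s) - φ t‖ ≤ C * (1 + |s|) := by
  obtain ⟨δ, hδ, H⟩ := Metric.uniformContinuous_iff.1 hφ 1 one_pos
  have key : ∀ (n : ℕ) (t r : ℝ), |r| < δ → ‖φ (t + n * r) - φ t‖ ≤ n := by
    intro n t r hr
    induction n with
    | zero => simp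
    | succ n ih =>
      have h1 : dist (φ (t + (n + 1 : ℕ) * r)) (φ (t + n * r)) < 1 := by
        apply H
        rw [Real.dist_eq]
        convert hr using 2
        push_cast
        ring
      rw [dist_eq_norm] at h1
      calc ‖φ (t + (n + 1 : ℕ) * r) - φ t‖
          ≤ ‖φ (t + (n + 1 : ℕ) * r) - φ (t + n * r)‖ + ‖φ (t + n * r) - φ t‖ :=
            norm_sub_le_norm_sub_add_norm_sub _ _ _
        _ ≤ ((n + 1 : ℕ) : ℝ) := by rw [Nat.cast_succ] at h1 ⊢; linarith
  refine ⟨1 + 1 / δ, by positivity, fun t s => ?_⟩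
  set n : ℕ := ⌊|s| / δ⌋₊ + 1 with hn
  have hn0 : (0 : ℝ) < n := by rw [hn]; positivity
  have hlt : |s| / δ < n := by rw [hn]; push_cast; exact Nat.lt_floor_add_one _
  have hle : (n : ℝ) ≤ |s| / δ + 1 := by
    rw [hn]
    push_cast
    gcongr
    exact Nat.floor_le (by positivity)
  have hr : |s / n| < δ := by
    rw [abs_div, abs_of_pos hn0, div_lt_iff₀ hn0]
    rwa [div_lt_iff₀ hδ, mul_comm] at hlt
  have h2 := key n t (s / n) hr
  rw [mul_div_cancel₀ _ hn0.ne'] at h2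
  have h3 : (1 + 1 / δ) * (1 + |s|) = |s| / δ + 1 + (1 / δ + |s|) := by ring
  have h4 : 0 ≤ 1 / δ + |s| := by positivity
  linarith

theorem norm_exp_I_mul_ofReal_sub_one_le (x : ℝ) : ‖Complex.exp (Complex.I * x) - 1‖ ≤ |x| := by
  simpa using Real.norm_exp_I_mul_ofReal_sub_one_le (x := x)

theorem norm_intervalIntegral_zero_le {E : Type*} [NormedAddCommGroup E] [NormedSpace ℝ E]
    {f : ℝ → E} {h C : ℝ} (hh : 0 ≤ h) (hf : ∀ s ∈ Set.Icc 0 h, ‖f s‖ ≤ C) :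
    ‖∫ s in (0 : ℝ)..h, f s‖ ≤ C * h := by
  simpa [abs_of_nonneg hh] using norm_integral_le_of_norm_le_const (a := 0) (b := h) (f := f)
    (C := C) fun s hs => hf s (Set.Ioc_subset_Icc_self (by rwa [Set.uIoc_of_le hh] at hs))

/-- Decay of a Fourier integral with differentiable amplitude. -/
theorem norm_integral_exp_mul_le {K K' : ℝ → ℂ} (hK : ∀ s, HasDerivAt K (K' s) s)
    (hK' : Continuous K') {h A B : ℝ} (hh : 0 ≤ h) (hA : ∀ s ∈ Set.Icc 0 h, ‖K s‖ ≤ A)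
    (hB : ∀ s ∈ Set.Icc 0 h, ‖K' s‖ ≤ B) (t : ℝ) :
    ‖∫ s in (0 : ℝ)..h, Complex.exp (Complex.I * (2 * t * s : ℝ)) * K s‖ * (1 + |t|) ≤
      (h + 2) * A + h * B := by
  set e : ℝ → ℂ := fun s => Complex.exp (Complex.I * (2 * t * s : ℝ)) with he
  have hnorm : ∀ s, ‖e s‖ = 1 := fun s => Complex.norm_exp_I_mul_ofReal _
  have hcK : Continuous K := continuous_iff_continuousAt.2 fun s => (hK s).continuousAt
  have hce : Continuous e := by fun_prop
  have hde : ∀ s, HasDerivAt e (Complex.I * (2 * t : ℝ) * e s) s := by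
    intro s
    have h1 : HasDerivAt (fun s : ℝ => Complex.I * ((2 * t * s : ℝ) : ℂ))
        (Complex.I * (2 * t : ℝ)) s := by
      simpa using (((hasDerivAt_id s).const_mul (2 * t)).ofReal_comp).const_mul Complex.I
    simpa [he, mul_comm] using h1.cexp
  have hparts := integral_mul_deriv_eq_deriv_mul (a := 0) (b := h) (u := K) (v := e)
    (fun s _ => hK s) (fun s _ => hde s) (hK'.intervalIntegrable _ _)
    ((continuous_const.mul hce).intervalIntegrable _ _)
  have hA0 : 0 ≤ A := (norm_nonneg _).trans (hA 0 ⟨le_rfl, hh⟩)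
  have hB0 : 0 ≤ B := (norm_nonneg _).trans (hB 0 ⟨le_rfl, hh⟩)
  have h1 : ‖∫ s in (0 : ℝ)..h, e s * K s‖ ≤ A * h :=
    norm_intervalIntegral_zero_le hh fun s hs => by simpa [hnorm] using hA s hs
  have h2 : ‖∫ s in (0 : ℝ)..h, K' s * e s‖ ≤ B * h :=
    norm_intervalIntegral_zero_le hh fun s hs => by simpa [hnorm] using hB s hs
  have h3 : (∫ s in (0 : ℝ)..h, K s * (Complex.I * (2 * t : ℝ) * e s)) =
      Complex.I * (2 * t : ℝ) * ∫ s in (0 : ℝ)..h, e s * K s := by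
    rw [← integral_const_mul]
    congr 1
    ext s
    ring
  rw [h3] at hparts
  have h4 : 2 * |t| * ‖∫ s in (0 : ℝ)..h, e s * K s‖ ≤ A + A + B * h := by
    calc 2 * |t| * ‖∫ s in (0 : ℝ)..h, e s * K s‖
        = ‖Complex.I * (2 * t : ℝ) * ∫ s in (0 : ℝ)..h, e s * K s‖ := by
          simp
      _ = ‖K h * e h - K 0 * e 0 - ∫ s in (0 : ℝ)..h, K' s * e s‖ := by rw [hparts]
      _ ≤ ‖K h * e h‖ + ‖K 0 * e 0‖ + ‖∫ s in (0 : ℝ)..h, K' s * e s‖ :=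
          (norm_sub_le _ _).trans (by gcongr; exact norm_sub_le _ _)
      _ ≤ A + A + B * h := by
          rw [norm_mul, norm_mul, hnorm, hnorm, mul_one, mul_one]
          gcongr
          · exact hA h ⟨hh, le_rfl⟩
          · exact hA 0 ⟨le_rfl, hh⟩
  linarith [mul_nonneg hh hB0]

/-- Oscillation compensates the linear growth of a uniformly continuous function. -/
theorem UniformContinuous.exists_norm_integral_exp_mul_smul_le {X : Type*} [NormedAddCommGroup X]
    [NormedSpace ℂ X] [CompleteSpace X] {φ : ℝ → X} (hφ : UniformContinuous φ) {h : ℝ}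
    (hh : 0 ≤ h) :
    ∃ M, 0 ≤ M ∧ ∀ (K K' : ℝ → ℂ), (∀ s, HasDerivAt K (K' s) s) → Continuous K' → ∀ A B : ℝ,
      (∀ s ∈ Set.Icc 0 h, ‖K s‖ ≤ A) → (∀ s ∈ Set.Icc 0 h, ‖K' s‖ ≤ B) → ∀ t : ℝ,
      ‖∫ s in (0 : ℝ)..h, (Complex.exp (Complex.I * (2 * t * s : ℝ)) * K s) • φ (t + s)‖ ≤
        M * (A + B) := by
  obtain ⟨C, hC, hgrowth⟩ := hφ.exists_norm_sub_le_mul_one_add_abs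
  set P := ‖φ 0‖ + C
  have hP : 0 ≤ P := by positivity
  have hφP : ∀ t, ‖φ t‖ ≤ P * (1 + |t|) := by
    intro t
    have h1 := hgrowth 0 t
    rw [zero_add] at h1
    have h2 := norm_le_norm_add_norm_sub' (φ t) (φ 0)
    have h3 := mul_nonneg (norm_nonneg (φ 0)) (abs_nonneg t)
    have h4 : P * (1 + |t|) = ‖φ 0‖ + ‖φ 0‖ * |t| + C * (1 + |t|) := by ring
    linarith
  refine ⟨P * (h + 2) + C * (1 + h) * h, by positivity, fun K K' hK hK' A B hA hB t => ?_⟩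
  set e : ℝ → ℂ := fun s => Complex.exp (Complex.I * (2 * t * s : ℝ))
  have hnorm : ∀ s, ‖e s‖ = 1 := fun s => Complex.norm_exp_I_mul_ofReal _
  have hcK : Continuous K := continuous_iff_continuousAt.2 fun s => (hK s).continuousAt
  have hce : Continuous e := by fun_prop
  have hcφ := hφ.continuous
  have hA0 : 0 ≤ A := (norm_nonneg _).trans (hA 0 ⟨le_rfl, hh⟩)
  have hB0 : 0 ≤ B := (norm_nonneg _).trans (hB 0 ⟨le_rfl, hh⟩)
  have hsplit : (∫ s in (0 : ℝ)..h, (e s * K s) • φ (t + s)) =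
      (∫ s in (0 : ℝ)..h, e s * K s) • φ t +
        ∫ s in (0 : ℝ)..h, (e s * K s) • (φ (t + s) - φ t) := by
    rw [← intervalIntegral.integral_smul_const, ← integral_add]
    · simp [smul_sub]
    · exact Continuous.intervalIntegrable (by fun_prop) _ _
    · exact Continuous.intervalIntegrable (by fun_prop) _ _
  have h1 : ‖∫ s in (0 : ℝ)..h, (e s * K s) • (φ (t + s) - φ t)‖ ≤ A * (C * (1 + h)) * h := by
    refine norm_intervalIntegral_zero_le hh fun s hs => ?_
    rw [norm_smul, norm_mul, hnorm, one_mul]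
    have h2 : |s| ≤ h := by rw [abs_of_nonneg hs.1]; exact hs.2
    refine mul_le_mul (hA s hs) ((hgrowth t s).trans ?_) (norm_nonneg _) hA0
    gcongr
  have h2 : ‖(∫ s in (0 : ℝ)..h, e s * K s) • φ t‖ ≤ P * ((h + 2) * A + h * B) := by
    rw [norm_smul]
    calc ‖∫ s in (0 : ℝ)..h, e s * K s‖ * ‖φ t‖
        ≤ ‖∫ s in (0 : ℝ)..h, e s * K s‖ * (P * (1 + |t|)) := by gcongr; exact hφP t
      _ = P * (‖∫ s in (0 : ℝ)..h, e s * K s‖ * (1 + |t|)) := by ring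
      _ ≤ P * ((h + 2) * A + h * B) := by
          gcongr
          exact norm_integral_exp_mul_le hK hK' hh hA hB t
  rw [hsplit]
  calc _ ≤ P * ((h + 2) * A + h * B) + A * (C * (1 + h)) * h := norm_add_le_of_le h2 h1
    _ ≤ _ := by
      have h3 : 0 ≤ P * B := by positivity
      have h4 : 0 ≤ C * (1 + h) * h * B := by positivity
      linarith

theorem stmt6 (X : Type*) [NormedAddCommGroup X] [NormedSpace ℂ X] [CompleteSpace X]
    (φ : ℝ → X) (hφ : UniformContinuous φ) (l : ℝ) (h : ℝ) (hh : 0 < h) :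
    ∃ u : ℝ → X, (UniformContinuous u ∧ ∃ C, ∀ t, ‖u t‖ ≤ C) ∧
      ∀ t : ℝ, (1 / h) • (∫ s in (0:ℝ)..h, (g (t + s) * gamma l (t + s)) • φ (t + s)) =
        g t • u t := by
  obtain ⟨M, hM, hosc⟩ := hφ.exists_norm_integral_exp_mul_smul_le hh.le
  have hcφ := hφ.continuous
  set E : ℝ → ℝ → ℂ :=
    fun t s => Complex.exp (Complex.I * (s ^ 2 + 2 * t * s + l * (t + s) : ℝ)) with hE
  set w : ℝ → X := fun t => ∫ s in (0 : ℝ)..h, E t s • φ (t + s) with hw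
  have hEnorm : ∀ t s, ‖E t s‖ = 1 := fun t s => Complex.norm_exp_I_mul_ofReal _
  have hEcont : ∀ t, Continuous (E t) := fun t => by fun_prop
  set k : ℝ → ℂ := fun s => Complex.exp (Complex.I * (s ^ 2 + l * s : ℝ)) with hk
  have hknorm : ∀ s, ‖k s‖ = 1 := fun s => Complex.norm_exp_I_mul_ofReal _
  have hkcont : Continuous k := by fun_prop
  have hkderiv : ∀ s, HasDerivAt k (k s * (Complex.I * (2 * s + l : ℝ))) s := by
    intro s
    have h1 : HasDerivAt (fun s : ℝ => s ^ 2 + l * s) (2 * s + l) s := by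
      simpa using (hasDerivAt_pow 2 s).fun_add (hasDerivAt_const_mul l)
    exact (h1.ofReal_comp.const_mul Complex.I).cexp
  set L := 2 * h + |l|
  have hL0 : 0 ≤ L := by positivity
  have hL : ∀ s ∈ Set.Icc 0 h, |2 * s + l| ≤ L := by
    intro s hs
    refine (abs_add_le _ _).trans ?_
    rw [abs_of_nonneg (by linarith [hs.1])]
    simp only [L]
    linarith [hs.2]
  have hEk : ∀ t s, E t s = Complex.exp (Complex.I * (l * t : ℝ)) *
      (Complex.exp (Complex.I * (2 * t * s : ℝ)) * k s) := by
    intro t s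
    simp only [hE, hk, ← Complex.exp_add]
    congr 1
    push_cast
    ring
  have hbdd : ∀ t, ‖w t‖ ≤ M * (1 + L) := by
    intro t
    have h1 := hosc k _ hkderiv (by fun_prop) 1 L (fun s _ => (hknorm s).le)
      (fun s hs => by
        rw [norm_mul, hknorm, norm_mul, Complex.norm_I, Complex.norm_real]
        simpa using hL s hs) t
    simp only [hw, hEk, mul_smul _ (_ * _ : ℂ), integral_smul, norm_smul,
      Complex.norm_exp_I_mul_ofReal, one_mul]
    exact h1
  have hdiff : ∀ t d ε : ℝ, (∀ s, ‖φ (t + d + s) - φ (t + s)‖ ≤ ε) →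
      ‖w (t + d) - w t‖ ≤ ε * h + M * (L + (L ^ 2 + 2)) * |d| := by
    intro t d ε hε
    set q : ℝ → ℂ := fun s => Complex.exp (Complex.I * ((2 * s + l) * d : ℝ)) with hq
    have hqnorm : ∀ s, ‖q s‖ = 1 := fun s => Complex.norm_exp_I_mul_ofReal _
    have hqcont : Continuous q := by fun_prop
    have hqderiv : ∀ s, HasDerivAt q (q s * (Complex.I * (2 * d : ℝ))) s := by
      intro s
      have h1 : HasDerivAt (fun s : ℝ => (2 * s + l) * d) (2 * d) s := by
        simpa using (((hasDerivAt_id s).const_mul 2).add_const l).mul_const d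
      exact (h1.ofReal_comp.const_mul Complex.I).cexp
    have hq1 : ∀ s ∈ Set.Icc 0 h, ‖q s - 1‖ ≤ L * |d| := by
      intro s hs
      refine (norm_exp_I_mul_ofReal_sub_one_le _).trans ?_
      rw [abs_mul]
      gcongr
      exact hL s hs
    have hEq : ∀ s, E (t + d) s = E t s * q s := by
      intro s
      simp only [hE, hq, ← Complex.exp_add]
      congr 1
      push_cast
      ring
    have hsplit : w (t + d) - w t =
        (∫ s in (0 : ℝ)..h, E (t + d) s • (φ (t + d + s) - φ (t + s))) +
        Complex.exp (Complex.I * (l * t : ℝ)) • ∫ s in (0 : ℝ)..h,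
          (Complex.exp (Complex.I * (2 * t * s : ℝ)) * (k s * (q s - 1))) • φ (t + s) := by
      have := hEcont t
      have := hEcont (t + d)
      rw [← integral_smul, ← integral_add, hw, ← integral_sub]
      · congr 1
        ext s
        rw [smul_smul, hEq, hEk t s]
        module
      all_goals exact Continuous.intervalIntegrable (by fun_prop) _ _
    have h1 : ‖∫ s in (0 : ℝ)..h, E (t + d) s • (φ (t + d + s) - φ (t + s))‖ ≤ ε * h :=
      norm_intervalIntegral_zero_le hh.le fun s _ => by
        rw [norm_smul, hEnorm, one_mul]
        exact hε s
    have h2 := hosc (fun s => k s * (q s - 1)) _ (fun s => (hkderiv s).mul ((hqderiv s).sub_const 1))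
      (by fun_prop) (L * |d|) (L * (L * |d|) + 2 * |d|)
      (fun s hs => by
        rw [norm_mul, hknorm, one_mul]
        exact hq1 s hs)
      (fun s hs => by
        refine norm_add_le_of_le ?_ ?_
        · rw [norm_mul, norm_mul, hknorm, norm_mul, Complex.norm_I, Complex.norm_real, one_mul,
            one_mul]
          exact mul_le_mul (hL s hs) (hq1 s hs) (norm_nonneg _) hL0
        · rw [norm_mul, norm_mul, hknorm, hqnorm, norm_mul, Complex.norm_I, Complex.norm_real]
          simp) t
    rw [hsplit]
    refine (norm_add_le _ _).trans (add_le_add h1 ?_)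
    rw [norm_smul, Complex.norm_exp_I_mul_ofReal, one_mul]
    exact h2.trans_eq (by ring)
  have hwuc : UniformContinuous w := by
    rw [Metric.uniformContinuous_iff]
    intro ε hε
    set N := M * (L + (L ^ 2 + 2))
    have hN : 0 ≤ N := by positivity
    obtain ⟨δ, hδ, H⟩ := Metric.uniformContinuous_iff.1 hφ (ε / (2 * h)) (by positivity)
    refine ⟨min δ (ε / (2 * (N + 1))), by positivity, fun {a b} hab => ?_⟩
    obtain ⟨hab₁, hab₂⟩ := lt_min_iff.1 hab
    rw [Real.dist_eq] at hab₁ hab₂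
    have h1 := hdiff b (a - b) (ε / (2 * h)) fun s => by
      rw [← dist_eq_norm]
      refine (H ?_).le
      rwa [Real.dist_eq, add_sub_cancel, add_sub_add_right_eq_sub]
    rw [add_sub_cancel] at h1
    rw [dist_eq_norm]
    rw [lt_div_iff₀ (by positivity)] at hab₂
    have h2 : ε / (2 * h) * h = ε / 2 := by field_simp
    linarith [abs_nonneg (a - b)]
  refine ⟨fun t => (1 / h) • w t, ⟨hwuc.const_smul _, (1 / h) * (M * (1 + L)), fun t => ?_⟩,
    fun t => ?_⟩
  · rw [norm_smul, Real.norm_of_nonneg (by positivity)]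
    gcongr
    exact hbdd t
  · simp only [hw]
    rw [smul_comm (g t), ← intervalIntegral.integral_smul (g t)]
    congr 1
    refine intervalIntegral.integral_congr fun s _ => ?_
    simp only [smul_smul]
    congr 1
    simp only [g, gamma, hE, ← Complex.exp_add]
    congr 1
    push_cast
    ring
end

section
/- (De Bruijn's theorem) Let φ : ℝ → ℂ be a function such that for every s > 0 the function Δ_s φ : t ↦ φ(t+s) − φ(t) is continuous on ℝ. Then φ = G + H, where G : ℝ → ℂ is continuous and H : ℝ → ℂ is additive, i.e. H(t+s) = H(t) + H(s) for all t, s ∈ ℝ. -/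
open Filter Topology intervalIntegral

section DeBruijn

variable {E : Type*} [NormedAddCommGroup E]

theorem continuous_add_sub_of_pos {f : ℝ → E}
    (hf : ∀ s > 0, Continuous fun t => f (t + s) - f t) (s : ℝ) :
    Continuous fun t => f (t + s) - f t := by
  rcases lt_trichotomy s 0 with hs | rfl | hs
  · have := ((hf (-s) (by linarith)).comp (continuous_add_const s)).neg
    refine this.congr fun t => ?_
    simp [Function.comp_def]
  · simpa using continuous_const
  · exact hf s hs

/-- If all differences of `f` are continuous, then along any null sequence `u` the second
differences of `f` tend to zero locally uniformly. -/
theorem tendstoLocallyUniformly_second_difference {f : ℝ → E}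
    (hf : ∀ s, Continuous fun t => f (t + s) - f t) {u : ℕ → ℝ} (hu : Tendsto u atTop (𝓝 0)) :
    TendstoLocallyUniformly (fun n s => (f (s + u n) - f s) - (f (u n) - f 0)) 0 atTop := by
  rw [Metric.tendstoLocallyUniformly_iff]
  intro ε hε t
  let D : ℕ → ℝ → E := fun n s => (f (s + u n) - f s) - (f (u n) - f 0)
  have hD : ∀ n, Continuous (D n) := fun n => (hf (u n)).sub continuous_const
  have hlim : ∀ s, Tendsto (fun n => D n s) atTop (𝓝 0) := by
    intro s
    have h := ((hf s).tendsto 0).comp hu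
    rw [tendsto_iff_norm_sub_tendsto_zero] at h
    rw [tendsto_zero_iff_norm_tendsto_zero]
    refine h.congr fun n => ?_
    simp only [D, Function.comp_apply, zero_add, add_comm (u n) s]
    congr 1
    abel
  obtain ⟨N, s₀, hs₀⟩ := nonempty_interior_of_iUnion_of_closed
    (f := fun N : ℕ => {s : ℝ | ∀ n ≥ N, ‖D n s‖ ≤ ε / 4})
    (fun N => by
      simp only [Set.ofPred_forall]
      exact isClosed_iInter fun n => isClosed_iInter fun _ =>
        isClosed_le (hD n).norm continuous_const)
    (by
      refine Set.eq_univ_of_forall fun s => Set.mem_iUnion.2 ?_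
      have h := (tendsto_zero_iff_norm_tendsto_zero.1 (hlim s)).eventually_le_const
        (show 0 < ε / 4 by positivity)
      exact eventually_atTop.1 h)
  set v := t - s₀ with hv
  obtain ⟨δ₁, hδ₁, hball⟩ := Metric.mem_nhds_iff.1 (mem_interior_iff_mem_nhds.1 hs₀)
  obtain ⟨δ₂, hδ₂, hcont⟩ := Metric.continuous_iff.1 (hf v) s₀ (ε / 4) (by positivity)
  refine ⟨Metric.ball t (min δ₁ (δ₂ / 2)), Metric.ball_mem_nhds _ (by positivity), ?_⟩
  filter_upwards [eventually_ge_atTop N, Metric.tendsto_nhds.1 hu (δ₂ / 2) (by positivity)]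
    with n hn hun y hy
  rw [Metric.mem_ball, Real.dist_eq, lt_min_iff] at hy
  rw [Real.dist_eq, sub_zero] at hun
  have hys : y - v - s₀ = y - t := by rw [hv]; ring
  have h₁ : ‖D n (y - v)‖ ≤ ε / 4 := by
    refine hball (a := y - v) ?_ n hn
    rw [Metric.mem_ball, Real.dist_eq, hys]
    exact hy.1
  have h₂ := hcont (y - v) (by rw [Real.dist_eq, hys]; linarith [hy.2])
  have h₃ := hcont (y - v + u n) (by
    rw [Real.dist_eq, show y - v + u n - s₀ = (y - t) + u n by rw [hv]; ring]
    linarith [abs_add_le (y - t) (u n), hy.2])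
  have h₄ := (dist_triangle_right _ _ _).trans_lt (add_lt_add h₃ h₂)
  have hsplit : D n y = D n (y - v) +
      ((f (y - v + u n + v) - f (y - v + u n)) - (f (y - v + v) - f (y - v))) := by
    simp only [D, show y - v + u n + v = y + u n by ring, sub_add_cancel]
    abel
  rw [dist_eq_norm] at h₄
  simp only [Pi.zero_apply, dist_zero_left]
  change ‖D n y‖ < ε
  rw [hsplit]
  linarith [norm_add_le (D n (y - v))
    ((f (y - v + u n + v) - f (y - v + u n)) - (f (y - v + v) - f (y - v)))]

variable [NormedSpace ℝ E]

theorem tendsto_integral_second_difference {f : ℝ → E}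
    (hf : ∀ s, Continuous fun t => f (t + s) - f t) :
    Tendsto (fun u => ∫ s in (0 : ℝ)..1, ((f (s + u) - f s) - (f u - f 0))) (𝓝 0) (𝓝 0) := by
  refine tendsto_of_seq_tendsto fun u hu => Metric.tendsto_nhds.2 fun ε hε => ?_
  have h := (tendstoLocallyUniformlyOn_iff_tendstoUniformlyOn_of_compact isCompact_Icc).1
    ((tendstoLocallyUniformly_second_difference hf hu).tendstoLocallyUniformlyOn
      (s := Set.Icc 0 1))
  filter_upwards [Metric.tendstoUniformlyOn_iff.1 h (ε / 2) (by positivity)] with n hn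
  rw [dist_zero_right]
  refine (norm_integral_le_of_norm_le_const (C := ε / 2) fun s hs => ?_).trans_lt (by
    norm_num; linarith)
  rw [Set.uIoc_of_le zero_le_one] at hs
  have h := (hn s (Set.Ioc_subset_Icc_self hs)).le
  rwa [Pi.zero_apply, dist_zero_left] at h

/-- The mean over `[0, 1]` of the differences of `f`, corrected by a primitive of the unit-step
difference of `f` so that it becomes additive. -/
noncomputable def correctedMeanDifference (f : ℝ → E) (s : ℝ) : E :=
  (∫ t in (0 : ℝ)..1, (f (t + s) - f t)) - ∫ t in (0 : ℝ)..s, (f (t + 1) - f t)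

theorem correctedMeanDifference_add {f : ℝ → E}
    (hf : ∀ s, Continuous fun t => f (t + s) - f t) (s u : ℝ) :
    correctedMeanDifference f (s + u) =
      correctedMeanDifference f s + correctedMeanDifference f u := by
  have hi : ∀ s a b, IntervalIntegrable (fun t => f (t + s) - f t) MeasureTheory.volume a b :=
    fun s a b => (hf s).intervalIntegrable a b
  have hshift : ∀ r w, Continuous fun t => f (t + r + w) - f (t + r) :=
    fun r w => (hf w).comp (continuous_add_const r)
  have hcocycle : (∫ t in (0 : ℝ)..1, (f (t + (s + u)) - f t)) =
      (∫ t in (0 : ℝ)..1, (f (t + s) - f t)) + ∫ t in s..(s + 1), (f (t + u) - f t) := by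
    have h := integral_comp_add_right (a := 0) (b := 1) (fun t => f (t + u) - f t) s
    rw [zero_add, add_comm 1 s] at h
    rw [← h, ← integral_add (hi s 0 1) ((hshift s u).intervalIntegrable 0 1)]
    refine integral_congr fun t _ => ?_
    simp only [add_assoc]
    abel
  have hwindow : (∫ t in s..(s + 1), (f (t + u) - f t)) - (∫ t in (0 : ℝ)..1, (f (t + u) - f t)) =
      (∫ t in u..(s + u), (f (t + 1) - f t)) - ∫ t in (0 : ℝ)..s, (f (t + 1) - f t) := by
    have h₁ := integral_comp_add_right (a := 0) (b := s) (fun t => f (t + u) - f t) 1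
    have h₂ := integral_comp_add_right (a := 0) (b := s) (fun t => f (t + 1) - f t) u
    rw [zero_add] at h₁ h₂
    rw [integral_interval_sub_interval_comm' (hi u _ _) (hi u _ _) (hi u _ _), ← h₁, ← h₂,
      ← integral_sub ((hshift 1 u).intervalIntegrable 0 s) (hi u 0 s),
      ← integral_sub ((hshift u 1).intervalIntegrable 0 s) (hi 1 0 s)]
    refine integral_congr fun t _ => ?_
    simp only [add_right_comm t 1 u]
    abel
  have hprim := integral_add_adjacent_intervals (hi 1 0 u) (hi 1 u (s + u))
  simp only [correctedMeanDifference]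
  rw [hcocycle, ← hprim, sub_eq_iff_eq_add.1 hwindow]
  abel

theorem continuous_sub_correctedMeanDifference [CompleteSpace E] {f : ℝ → E}
    (hf : ∀ s, Continuous fun t => f (t + s) - f t) :
    Continuous fun t => f t - correctedMeanDifference f t := by
  have hzero : Tendsto (fun t => f t - correctedMeanDifference f t) (𝓝 0) (𝓝 (f 0)) := by
    have hprim : Tendsto (fun u => ∫ t in (0 : ℝ)..u, (f (t + 1) - f t)) (𝓝 0) (𝓝 0) := by
      have h := (continuous_primitive (μ := MeasureTheory.volume)
        (fun a b => (hf 1).intervalIntegrable a b) 0).tendsto 0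
      rwa [integral_same] at h
    have h := (tendsto_const_nhds (x := f 0)).add
      (hprim.sub (tendsto_integral_second_difference hf))
    rw [sub_zero, add_zero] at h
    refine h.congr fun u => ?_
    rw [integral_sub ((hf u).intervalIntegrable 0 1) intervalIntegrable_const]
    simp only [correctedMeanDifference, integral_const, sub_zero, one_smul]
    abel
  refine continuous_iff_continuousAt.2 fun t => ?_
  have hsub : Tendsto (fun x => x - t) (𝓝 t) (𝓝 0) := by
    simpa using (continuous_sub_right t).tendsto t
  have h := (hzero.comp hsub).add
    ((((hf t).tendsto 0).comp hsub).sub_const (correctedMeanDifference f t))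
  have heq : ∀ x, f (x - t) - correctedMeanDifference f (x - t) +
      (f (x - t + t) - f (x - t) - correctedMeanDifference f t) =
        f x - correctedMeanDifference f x := by
    intro x
    have hadd := correctedMeanDifference_add hf (x - t) t
    rw [sub_add_cancel] at hadd ⊢
    rw [hadd]
    abel
  have hval : f 0 + (f (0 + t) - f 0 - correctedMeanDifference f t) =
      f t - correctedMeanDifference f t := by
    rw [zero_add]
    abel
  rw [hval] at h
  exact h.congr heq

end DeBruijn

theorem stmt7 (φ : ℝ → ℂ)
    (h : ∀ s > (0:ℝ), Continuous (fun t => φ (t + s) - φ t)) :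
    ∃ G H : ℝ → ℂ, Continuous G ∧ (∀ t s : ℝ, H (t + s) = H t + H s) ∧
      ∀ t, φ t = G t + H t := by
  have hφ := continuous_add_sub_of_pos h
  exact ⟨fun t => φ t - correctedMeanDifference φ t, correctedMeanDifference φ,
    continuous_sub_correctedMeanDifference hφ, correctedMeanDifference_add hφ,
    fun t => (sub_add_cancel _ _).symm⟩
end

section
/- Let X be a complex Banach space and let φ : ℝ → X be a function such that for every h > 0 there exists a uniformly continuous function u_h : ℝ → X with g(t+h)·φ(t+h) − g(t)·φ(t) = g(t)·u_h(t) for all t ∈ ℝ (i.e. Δ_h(g·φ) ∈ g·UC(ℝ,X) for every h > 0). Then φ is continuous. -/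
open Filter Topology in
/-- A pointwise limit of continuous functions on a nonempty Baire space has points of arbitrarily
small oscillation. -/
theorem exists_eventually_dist_le_of_tendsto {Y E : Type*} [TopologicalSpace Y] [BaireSpace Y]
    [Nonempty Y] [PseudoMetricSpace E] {F : ℕ → Y → E} {f : Y → E} (hF : ∀ n, Continuous (F n))
    (hlim : ∀ y, Tendsto (fun n => F n y) atTop (𝓝 (f y))) {ε : ℝ} (hε : 0 < ε) :
    ∃ y₀, ∀ᶠ y in 𝓝 y₀, dist (f y) (f y₀) ≤ ε := by
  let C : ℕ → Set Y := fun N => ⋂ n ≥ N, {y | dist (F n y) (F N y) ≤ ε / 3}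
  have hC : ∀ N, IsClosed (C N) := fun N =>
    isClosed_biInter fun n _ => isClosed_le ((hF n).dist (hF N)) continuous_const
  have hU : ⋃ N, C N = Set.univ := by
    refine Set.eq_univ_of_forall fun y => ?_
    obtain ⟨N, hN⟩ := Metric.cauchySeq_iff'.1 (hlim y).cauchySeq (ε / 3) (by positivity)
    exact Set.mem_iUnion.2 ⟨N, Set.mem_iInter₂.2 fun n hn => (hN n hn).le⟩
  obtain ⟨N, y₀, hy₀⟩ := nonempty_interior_of_iUnion_of_closed hC hU
  have hdist : ∀ y ∈ C N, dist (f y) (F N y) ≤ ε / 3 := fun y hy =>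
    le_of_tendsto ((hlim y).dist tendsto_const_nhds)
      ((eventually_ge_atTop N).mono fun n hn => Set.mem_iInter₂.1 hy n hn)
  refine ⟨y₀, ?_⟩
  filter_upwards [mem_interior_iff_mem_nhds.1 hy₀,
    Metric.continuousAt_iff'.1 (hF N).continuousAt (ε / 3) (by positivity)] with y hy hy'
  have h₁ := hdist y hy
  have h₂ := hdist y₀ (interior_subset hy₀)
  rw [dist_comm] at h₂
  linarith [dist_triangle4 (f y) (F N y) (F N y₀) (f y₀)]

open Filter Topology in
/-- A function on a topological group all of whose differences are continuous, and which has points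
of arbitrarily small oscillation, is continuous. -/
theorem continuous_of_continuous_sub {G E : Type*} [AddCommGroup G] [TopologicalSpace G]
    [ContinuousAdd G] [SeminormedAddCommGroup E] {f : G → E}
    (hdiff : ∀ h, Continuous fun t => f (t + h) - f t)
    (hosc : ∀ ε > 0, ∃ x₀, ∀ᶠ x in 𝓝 x₀, dist (f x) (f x₀) ≤ ε) : Continuous f := by
  refine continuous_iff_continuousAt.2 fun x => Metric.continuousAt_iff'.2 fun ε hε => ?_
  obtain ⟨x₀, hx₀⟩ := hosc (ε / 2) (by positivity)
  have hshift : Tendsto (fun y => y + (x₀ - x)) (𝓝 x) (𝓝 x₀) := by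
    have : Continuous fun y => y + (x₀ - x) := by fun_prop
    simpa using this.tendsto x
  have hD := Metric.continuousAt_iff'.1 ((hdiff (x - x₀)).continuousAt (x := x₀)) (ε / 2)
    (by positivity)
  filter_upwards [hshift.eventually hx₀, hshift.eventually hD] with y h₁ h₂
  have e₁ : y + (x₀ - x) + (x - x₀) = y := by abel
  have e₂ : x₀ + (x - x₀) = x := by abel
  rw [e₁, e₂] at h₂
  rw [dist_eq_norm] at *
  calc ‖f y - f x‖ = ‖(f y - f (y + (x₀ - x)) - (f x - f x₀))
        + (f (y + (x₀ - x)) - f x₀)‖ := by congr 1; abel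
    _ ≤ _ := norm_add_le _ _
    _ < ε := by linarith

theorem continuous_g : Continuous g := by
  unfold g
  fun_prop

theorem g_ne_zero (t : ℝ) : g t ≠ 0 := Complex.exp_ne_zero _

theorem norm_g (t : ℝ) : ‖g t‖ = 1 := by
  have : Complex.I * (t : ℂ) ^ 2 = ((t ^ 2 : ℝ) : ℂ) * Complex.I := by push_cast; ring
  rw [g, this, Complex.norm_exp_ofReal_mul_I]

theorem g_sqrt_sq_add_pi (t : ℝ) : g √(t ^ 2 + Real.pi) = -g t := by
  have h : 0 ≤ t ^ 2 + Real.pi := by positivity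
  unfold g
  rw [← Complex.ofReal_pow, Real.sq_sqrt h]
  push_cast
  rw [mul_add, Complex.exp_add, mul_comm Complex.I (Real.pi : ℂ), Complex.exp_pi_mul_I]
  ring

open Filter Topology in
theorem tendsto_sqrt_sq_add_pi_sub :
    Tendsto (fun t : ℝ => √(t ^ 2 + Real.pi) - t) atTop (𝓝 0) := by
  refine squeeze_zero' (g := fun t => Real.pi / t) ?_ ?_
    (tendsto_const_nhds.div_atTop tendsto_id)
  · filter_upwards with t
    exact sub_nonneg.2 (Real.le_sqrt_of_sq_le (by linarith [Real.pi_pos]))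
  · filter_upwards [eventually_gt_atTop 0] with t ht
    rw [sub_le_iff_le_add, Real.sqrt_le_left (by positivity)]
    have : (Real.pi / t + t) ^ 2 = (Real.pi / t) ^ 2 + 2 * Real.pi + t ^ 2 := by
      field_simp
      ring
    rw [this]
    linarith [Real.pi_pos, sq_nonneg (Real.pi / t)]

open Filter Topology in
/-- The values of `g • u` at `t` and `√(t ^ 2 + π)` cancel asymptotically when `u` is uniformly
continuous, because `g` takes opposite values there. -/
theorem tendsto_g_smul_add_g_smul_sqrt {X : Type*} [NormedAddCommGroup X] [NormedSpace ℂ X]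
    {u : ℝ → X} (hu : UniformContinuous u) :
    Tendsto (fun t => g t • u t + g √(t ^ 2 + Real.pi) • u √(t ^ 2 + Real.pi)) atTop (𝓝 0) := by
  refine Metric.tendsto_nhds.2 fun ε hε => ?_
  obtain ⟨δ, hδ, h⟩ := Metric.uniformContinuous_iff.1 hu ε hε
  filter_upwards [Metric.tendsto_nhds.1 tendsto_sqrt_sq_add_pi_sub δ hδ] with t ht
  rw [g_sqrt_sq_add_pi, neg_smul, ← sub_eq_add_neg, ← smul_sub, dist_zero_right, norm_smul,
    norm_g, one_mul, ← dist_eq_norm, dist_comm]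
  apply h
  rwa [dist_zero_right, ← dist_eq_norm] at ht

theorem stmt9 (X : Type*) [NormedAddCommGroup X] [NormedSpace ℂ X] [CompleteSpace X]
    (φ : ℝ → X)
    (hyp : ∀ h > (0:ℝ), ∃ u : ℝ → X, UniformContinuous u ∧
      ∀ t, g (t + h) • φ (t + h) - g t • φ t = g t • u t) :
    Continuous φ := by
  set f : ℝ → X := fun t => g t • φ t with hf
  have hpos : ∀ h > 0, Continuous fun t => f (t + h) - f t := fun h hh => by
    obtain ⟨u, hu, hut⟩ := hyp h hh
    exact (continuous_g.smul hu.continuous).congr fun t => (hut t).symm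
  have hdiff : ∀ h, Continuous fun t => f (t + h) - f t := fun h => by
    rcases lt_trichotomy h 0 with hh | rfl | hh
    · have : Continuous fun t => -(f (t + h + -h) - f (t + h)) :=
        ((hpos (-h) (by linarith)).comp (continuous_add_const h)).neg
      simpa using this
    · simpa using continuous_const
    · exact hpos h hh
  let a : ℕ → ℝ := fun n => √((n : ℝ) ^ 2 + Real.pi)
  let S : ℕ → ℝ → X := fun n s => (f (s + n) - f n) + (f (s + a n) - f (a n))
  have hS : ∀ s > 0, Filter.Tendsto (fun n => S n s) Filter.atTop (nhds 0) := fun s hs => by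
    obtain ⟨u, hu, hut⟩ := hyp s hs
    refine ((tendsto_g_smul_add_g_smul_sqrt hu).comp tendsto_natCast_atTop_atTop).congr fun n => ?_
    simp only [Function.comp, S, hf, a, ← hut, add_comm s]
  let F : ℕ → ℝ → X := fun n s => f s - (2⁻¹ : ℂ) • S n s
  have hF : ∀ n, Continuous (F n) := fun n => by
    have hc : Continuous fun s => (-2⁻¹ : ℂ) •
        ((f (s + n) - f s - f n) + (f (s + a n) - f s - f (a n))) :=
      (((hdiff n).sub continuous_const).add ((hdiff (a n)).sub continuous_const)).const_smul _
    refine hc.congr fun s => ?_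
    simp only [F, S]
    module
  have hlim : ∀ s > 0, Filter.Tendsto (fun n => F n s) Filter.atTop (nhds (f s)) := fun s hs => by
    simpa using tendsto_const_nhds.sub ((hS s hs).const_smul (2⁻¹ : ℂ))
  have hfc : Continuous f := by
    refine continuous_of_continuous_sub hdiff fun ε hε => ?_
    obtain ⟨x, hx⟩ := exists_eventually_dist_le_of_tendsto (F := fun n => F n ∘ Real.exp)
      (f := f ∘ Real.exp) (fun n => (hF n).comp Real.continuous_exp)
      (fun x => hlim _ (Real.exp_pos x)) hε
    refine ⟨Real.exp x, ?_⟩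
    have hlog : Filter.Tendsto Real.log (nhds (Real.exp x)) (nhds x) := by
      simpa using (Real.continuousAt_log (Real.exp_ne_zero x)).tendsto
    filter_upwards [hlog.eventually hx, lt_mem_nhds (Real.exp_pos x)] with y hy hy0
    simpa [Real.exp_log hy0] using hy
  refine ((continuous_g.inv₀ g_ne_zero).smul hfc).congr fun t => ?_
  exact inv_smul_smul₀ (g_ne_zero t) (φ t)
end
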